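/- Let n be a positive integer, let a_1, …, a_{2n} ∈ (−1, 1) be real numbers, and let P be a real polynomial of degree at most n. Define r(x) = P(x) / √(∏_{k=1}^{2n} (1 + a_k x)) and m_n(x) = cos( (1/2) ∑_{k=1}^{2n} arccos( (x + a_k)/(1 + a_k x) ) ) for x ∈ [−1, 1]. If |r(x)| ≤ 1 for all x ∈ [−1, 1], then sup_{x∈[−1,1]} |r′(x)| ≤ sup_{x∈[−1,1]} |m_n′(x)|. -/

import Mathlib

open Set Finset

namespace Rusak
open Complex Polynomial

variable {ι : Type*} [Fintype ι]

noncomputable def Gp (c : ι → ℝ) : ℂ[X] := ∏ k, (1 + C (I * (c k : ℂ)) * X)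

lemma Gp_eval (c : ι → ℝ) (z : ℂ) : (Gp c).eval z = ∏ k, (1 + I * (c k : ℂ) * z) := by
  simp [Gp, eval_prod]

lemma factor_bound {c : ℝ} (hc : 0 < c) {z : ℂ} (hz : z.im ≤ 0) :
    1 + ‖z‖ ≤ (1 + 1 / c) * ‖1 + I * (c : ℂ) * z‖ := by
  have h1 : 1 ≤ ‖1 + I * (c : ℂ) * z‖ := by
    refine le_trans ?_ (Complex.re_le_norm _)
    simp
    nlinarith
  have h2 : c * ‖z‖ ≤ ‖1 + I * (c : ℂ) * z‖ := by
    apply le_of_sq_le_sq _ (norm_nonneg _)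
    rw [mul_pow, Complex.sq_norm, Complex.sq_norm, Complex.normSq_apply, Complex.normSq_apply]
    simp
    nlinarith
  have h3 : ‖z‖ ≤ (1 / c) * ‖1 + I * (c : ℂ) * z‖ := by
    rw [one_div, le_inv_mul_iff₀ hc]; exact h2
  linarith

lemma factor_ne {c : ℝ} (hc : 0 < c) {z : ℂ} (hz : z.im ≤ 0) : 1 + I * (c : ℂ) * z ≠ 0 := by
  intro h
  have := factor_bound hc hz
  rw [h] at this
  simp at this
  linarith [norm_nonneg z]

lemma Gp_ne {c : ι → ℝ} (hc : ∀ k, 0 < c k) {z : ℂ} (hz : z.im ≤ 0) : (Gp c).eval z ≠ 0 := by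
  rw [Gp_eval]
  exact Finset.prod_ne_zero_iff.2 fun k _ => factor_ne (hc k) hz

lemma R_bound (R : ℂ[X]) {N : ℕ} (hR : R.natDegree ≤ N) (z : ℂ) :
    ‖R.eval z‖ ≤ (∑ j ∈ range (N + 1), ‖R.coeff j‖) * (1 + ‖z‖) ^ N := by
  rw [eval_eq_sum_range' (Nat.lt_succ_of_le hR), Finset.sum_mul]
  refine (norm_sum_le _ _).trans (Finset.sum_le_sum fun j hj => ?_)
  rw [norm_mul, norm_pow]
  gcongr
  calc ‖z‖ ^ j ≤ (1 + ‖z‖) ^ j := by gcongr; linarith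
    _ ≤ (1 + ‖z‖) ^ N := by
      apply pow_le_pow_right₀ (by linarith [norm_nonneg z])
      have := Finset.mem_range.1 hj; omega

lemma ratio_bound {c : ι → ℝ} (hc : ∀ k, 0 < c k) (R : ℂ[X]) (hR : R.natDegree ≤ Fintype.card ι) :
    ∃ K : ℝ, ∀ z : ℂ, z.im ≤ 0 → ‖R.eval z / (Gp c).eval z‖ ≤ K := by
  refine ⟨(∑ j ∈ range (Fintype.card ι + 1), ‖R.coeff j‖) * ∏ k, (1 + 1 / c k), fun z hz => ?_⟩
  rw [norm_div, div_le_iff₀ (norm_pos_iff.2 (Gp_ne hc hz))]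
  refine (R_bound R hR z).trans ?_
  rw [mul_assoc]
  refine mul_le_mul_of_nonneg_left ?_ (Finset.sum_nonneg fun _ _ => norm_nonneg _)
  rw [Gp_eval, norm_prod, ← Finset.prod_mul_distrib, ← Finset.card_univ, ← Finset.prod_const]
  exact Finset.prod_le_prod (fun _ _ => by positivity) (fun k _ => factor_bound (hc k) hz)

lemma PL {c : ι → ℝ} (hc : ∀ k, 0 < c k) (R : ℂ[X]) (hR : R.natDegree ≤ Fintype.card ι)
    {s : ℝ} (hs : ∀ t : ℝ, ‖R.eval (t : ℂ)‖ ≤ s * ‖(Gp c).eval (t : ℂ)‖)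
    {z : ℂ} (hz : z.im ≤ 0) : ‖R.eval z‖ ≤ s * ‖(Gp c).eval z‖ := by
  obtain ⟨K, hK⟩ := ratio_bound hc R hR
  have him : ∀ w : ℂ, 0 ≤ w.re → (-I * w).im ≤ 0 := fun w hw => by simp [hw]
  set f : ℂ → ℂ := fun w => R.eval (-I * w) / (Gp c).eval (-I * w) with hf
  have key : ‖f (I * z)‖ ≤ s := by
    apply PhragmenLindelof.right_half_plane_of_bounded_on_real (f := f) (C := s)
    · have hd : DifferentiableOn ℂ f {w | 0 ≤ w.re} := by
        intro w hw
        apply DifferentiableAt.differentiableWithinAt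
        apply DifferentiableAt.div
        · exact (R.differentiable).differentiableAt.comp w (by fun_prop)
        · exact ((Gp c).differentiable).differentiableAt.comp w (by fun_prop)
        · exact Gp_ne hc (him w hw)
      apply DifferentiableOn.diffContOnCl
      refine hd.mono ?_
      rw [Complex.closure_setOfPred_lt_re]
    · refine ⟨1, by norm_num, 0, ?_⟩
      simp only [zero_mul, Real.exp_zero]
      apply Asymptotics.IsBigO.of_bound K
      rw [Filter.eventually_inf_principal]
      filter_upwards with w hw
      have h := hK _ (him w (le_of_lt hw))
      rw [norm_one, mul_one]
      exact h
    · refine Filter.isBoundedUnder_of_eventually_le (a := K) ?_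
      filter_upwards [Filter.eventually_ge_atTop 0] with x hx
      exact hK _ (him x (by simpa using hx))
    · intro x
      have : -I * (x * I) = (x : ℂ) := by
        rw [mul_comm (x:ℂ), ← mul_assoc]; simp
      simp only [hf, this, norm_div]
      rw [div_le_iff₀ (norm_pos_iff.2 (Gp_ne hc (by simp)))]
      exact hs x
    · simpa using hz
  have e : -I * (I * z) = z := by rw [← mul_assoc]; simp
  simp only [hf, e, norm_div] at key
  rwa [div_le_iff₀ (norm_pos_iff.2 (Gp_ne hc hz))] at key

lemma T_ne {c : ι → ℝ} (hc : ∀ k, 0 < c k) (R : ℂ[X]) (hR : R.natDegree ≤ Fintype.card ι)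
    {s : ℝ} (hs1 : s < 1) (hs : ∀ t : ℝ, ‖R.eval (t : ℂ)‖ ≤ s * ‖(Gp c).eval (t : ℂ)‖)
    {e : ℂ} (he : ‖e‖ = 1) {z : ℂ} (hz : z.im ≤ 0) : (C e * Gp c - R).eval z ≠ 0 := by
  intro h
  have h1 := PL hc R hR hs hz
  have h2 : R.eval z = e * (Gp c).eval z := by
    simp [sub_eq_zero] at h; exact h.symm
  rw [h2, norm_mul, he, one_mul] at h1
  have := norm_pos_iff.2 (Gp_ne hc hz)
  nlinarith

lemma im_logDeriv {T : ℂ[X]} (hT : ∀ z : ℂ, z.im ≤ 0 → T.eval z ≠ 0) (t : ℝ) :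
    0 ≤ (T.derivative.eval (t : ℂ) / T.eval (t : ℂ)).im := by
  rw [(IsAlgClosed.splits T).eval_derivative_div_eval_of_ne_zero (hT _ (by simp))]
  rw [← Complex.imCLM_apply, map_multiset_sum, Multiset.map_map]
  apply Multiset.sum_nonneg
  intro x hx
  obtain ⟨z, hz, rfl⟩ := Multiset.mem_map.1 hx
  have hz0 : 0 < z.im := by
    by_contra h
    exact hT z (not_lt.1 h) (Polynomial.isRoot_of_mem_roots hz)
  have h1 : (1 / ((t : ℂ) - z)).im = z.im / Complex.normSq ((t : ℂ) - z) := by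
    simp
  simp only [Function.comp, Complex.imCLM_apply, h1]
  exact div_nonneg hz0.le (Complex.normSq_nonneg _)


noncomputable def DD (c : ι → ℝ) (t : ℝ) : ℝ := ∏ k, Real.sqrt (1 + (c k * t) ^ 2)
noncomputable def ps (c : ι → ℝ) (t : ℝ) : ℝ := ∑ k, Real.arctan (c k * t)
noncomputable def dps (c : ι → ℝ) (t : ℝ) : ℝ := ∑ k, c k / (1 + (c k * t) ^ 2)

lemma DD_pos (c : ι → ℝ) (t : ℝ) : 0 < DD c t :=
  Finset.prod_pos fun k _ => Real.sqrt_pos.2 (by positivity)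

lemma hasDerivAt_ps (c : ι → ℝ) (t : ℝ) : HasDerivAt (ps c) (dps c t) t := by
  unfold ps dps
  refine HasDerivAt.fun_sum fun k _ => ?_
  have := ((hasDerivAt_id' t).const_mul (c k)).arctan
  refine this.congr_deriv ?_
  rw [mul_one]; ring

lemma hasDerivAt_DD (c : ι → ℝ) (t : ℝ) : ∃ d, HasDerivAt (DD c) d t ∧ (0 ≤ t → 0 ≤ d) := by
  classical
  have h : ∀ k ∈ (Finset.univ : Finset ι), HasDerivAt (fun t => Real.sqrt (1 + (c k * t) ^ 2))
      ((c k) ^ 2 * t / Real.sqrt (1 + (c k * t) ^ 2)) t := by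
    intro k _
    have h1 : HasDerivAt (fun t : ℝ => 1 + (c k * t) ^ 2) (2 * (c k * t) * c k) t := by
      have := (((hasDerivAt_id' t).const_mul (c k)).pow 2).const_add 1
      refine this.congr_deriv ?_
      simp
    have h2 := h1.sqrt (by positivity)
    convert h2 using 1
    field_simp
  refine ⟨_, HasDerivAt.fun_finsetProd h, fun ht => ?_⟩
  refine Finset.sum_nonneg fun k _ => ?_
  rw [smul_eq_mul]
  refine mul_nonneg (Finset.prod_nonneg fun _ _ => Real.sqrt_nonneg _) (by positivity)

lemma G_polar (c : ι → ℝ) (t : ℝ) :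
    (Gp c).eval (t : ℂ) = (DD c t : ℂ) * Complex.exp (I * (ps c t : ℂ)) := by
  rw [Gp_eval, DD, ps]
  rw [Complex.ofReal_prod, Complex.ofReal_sum, Finset.mul_sum, Complex.exp_sum, ← Finset.prod_mul_distrib]
  refine Finset.prod_congr rfl fun k _ => ?_
  have hs : Real.sqrt (1 + (c k * t) ^ 2) ≠ 0 := (Real.sqrt_pos.2 (by positivity)).ne'
  rw [mul_comm I (Real.arctan _ : ℂ), Complex.exp_mul_I, ← Complex.ofReal_cos,
    ← Complex.ofReal_sin, Real.cos_arctan, Real.sin_arctan]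
  apply Complex.ext
  · simp
    field_simp
  · simp
    field_simp

lemma norm_G (c : ι → ℝ) (t : ℝ) : ‖(Gp c).eval (t : ℂ)‖ = DD c t := by
  rw [G_polar, norm_mul, mul_comm I, Complex.norm_exp_ofReal_mul_I, mul_one, Complex.norm_real,
    Real.norm_of_nonneg (DD_pos c t).le]

lemma G_deriv (c : ι → ℝ) (t : ℝ) {d : ℝ} (hd : HasDerivAt (DD c) d t) :
    (Gp c).derivative.eval (t : ℂ) =
      ((d : ℂ) + I * (DD c t : ℂ) * (dps c t : ℂ)) * Complex.exp (I * (ps c t : ℂ)) := by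
  have h1 : HasDerivAt (fun x : ℝ => (Gp c).eval (x : ℂ)) ((Gp c).derivative.eval (t : ℂ)) t :=
    ((Gp c).hasDerivAt (t : ℂ)).comp_ofReal
  have h2 : HasDerivAt (fun x : ℝ => (DD c x : ℂ) * Complex.exp (I * (ps c x : ℂ)))
      ((d : ℂ) * Complex.exp (I * (ps c t : ℂ)) + (DD c t : ℂ) *
        (Complex.exp (I * (ps c t : ℂ)) * (I * (dps c t : ℂ)))) t := by
    exact hd.ofReal_comp.mul (((hasDerivAt_ps c t).ofReal_comp.const_mul I).cexp)
  have h3 : (fun x : ℝ => (Gp c).eval (x : ℂ)) =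
      (fun x : ℝ => (DD c x : ℂ) * Complex.exp (I * (ps c x : ℂ))) := funext fun x => G_polar c x
  rw [h3] at h1
  rw [h1.unique h2]
  ring

lemma map_eval_real (R : ℝ[X]) (t : ℝ) :
    (R.map (algebraMap ℝ ℂ)).eval (t : ℂ) = ((R.eval t : ℝ) : ℂ) := by
  have := Polynomial.eval_map_algebraMap (B := ℂ) R (t : ℂ)
  rw [this]
  exact (Polynomial.aeval_algebraMap_apply_eq_algebraMap_eval (A := ℂ) t R)

lemma hs_complex {c : ι → ℝ} {R : ℝ[X]} {s : ℝ} (hs : ∀ t : ℝ, |R.eval t| ≤ s * DD c t) (t : ℝ) :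
    ‖(R.map (algebraMap ℝ ℂ)).eval (t : ℂ)‖ ≤ s * ‖(Gp c).eval (t : ℂ)‖ := by
  rw [map_eval_real, norm_G, Complex.norm_real]
  exact hs t

/-- polar form of the Bernstein-Szego inequality -/
lemma BS_polar {c : ι → ℝ} (hc : ∀ k, 0 < c k) (R : ℝ[X]) (hR : R.natDegree ≤ Fintype.card ι)
    {s : ℝ} (hs1 : s < 1) (hs : ∀ t : ℝ, |R.eval t| ≤ s * DD c t) (t f' : ℝ)
    (hf' : HasDerivAt (fun x => R.eval x / DD c x) f' t) {u v : ℝ} (huv : u ^ 2 + v ^ 2 = 1) :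
    0 ≤ dps c t * (1 - R.eval t / DD c t * u) + f' * v := by
  obtain ⟨d, hd, -⟩ := hasDerivAt_DD c t
  have hD := DD_pos c t
  have hf2 : f' = (R.derivative.eval t * DD c t - R.eval t * d) / DD c t ^ 2 :=
    hf'.unique ((R.hasDerivAt t).div hd hD.ne')
  have hRc : (R.map (algebraMap ℝ ℂ)).natDegree ≤ Fintype.card ι := natDegree_map_le.trans hR
  have hE : ‖Complex.exp (-(I * (ps c t : ℂ)))‖ = 1 := by
    rw [← mul_neg, mul_comm, ← Complex.ofReal_neg, Complex.norm_exp_ofReal_mul_I]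
  have he : ‖((u : ℂ) + v * I) * Complex.exp (-(I * (ps c t : ℂ)))‖ = 1 := by
    rw [norm_mul, hE, Complex.norm_add_mul_I, huv]; simp
  have hT := im_logDeriv (fun z hz => T_ne hc _ hRc hs1 (hs_complex hs) he hz) t
  have hEE : Complex.exp (-(I * (ps c t : ℂ))) * Complex.exp (I * (ps c t : ℂ)) = 1 := by
    rw [← Complex.exp_add]; simp
  have e1 : (C (((u : ℂ) + v * I) * Complex.exp (-(I * (ps c t : ℂ)))) * Gp c -
      R.map (algebraMap ℝ ℂ)).eval (t : ℂ) = (DD c t : ℂ) * (u + v * I) - (R.eval t : ℝ) := by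
    rw [eval_sub, map_eval_real, eval_mul, eval_C, G_polar]
    linear_combination ((DD c t : ℂ) * (u + v * I)) * hEE
  have e2 : (C (((u : ℂ) + v * I) * Complex.exp (-(I * (ps c t : ℂ)))) * Gp c -
      R.map (algebraMap ℝ ℂ)).derivative.eval (t : ℂ) =
      ((d : ℂ) + I * (DD c t : ℂ) * (dps c t : ℂ)) * (u + v * I) - (R.derivative.eval t : ℝ) := by
    rw [derivative_sub, derivative_C_mul, derivative_map, eval_sub, map_eval_real, eval_mul, eval_C,
      G_deriv c t hd]
    linear_combination (((d : ℂ) + I * (DD c t : ℂ) * (dps c t : ℂ)) * (u + v * I)) * hEE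
  have hne := T_ne hc _ hRc hs1 (hs_complex hs) he (z := (t : ℂ)) (by simp)
  rw [e1] at hne hT
  rw [e2] at hT
  have hpos := Complex.normSq_pos.2 hne
  rw [Complex.div_im, ← sub_div, le_div_iff₀ hpos, zero_mul] at hT
  simp at hT
  rw [hf2]
  have : dps c t * (1 - R.eval t / DD c t * u) +
      (R.derivative.eval t * DD c t - R.eval t * d) / DD c t ^ 2 * v =
      (DD c t ^ 2 * dps c t * (u ^ 2 + v ^ 2) - DD c t * dps c t * u * R.eval t +
        v * (R.derivative.eval t * DD c t - d * R.eval t)) / DD c t ^ 2 := by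
    rw [huv]; field_simp; try ring
  rw [this]
  apply div_nonneg _ (by positivity)
  linarith

lemma dps_pos_or {c : ι → ℝ} (hc : ∀ k, 0 < c k) (t : ℝ) : 0 ≤ dps c t :=
  Finset.sum_nonneg fun k _ => div_nonneg (hc k).le (by positivity)

lemma BS {c : ι → ℝ} (hc : ∀ k, 0 < c k) (R : ℝ[X]) (hR : R.natDegree ≤ Fintype.card ι)
    {s : ℝ} (hs1 : s < 1) (hs : ∀ t : ℝ, |R.eval t| ≤ s * DD c t) (t f' : ℝ)
    (hf' : HasDerivAt (fun x => R.eval x / DD c x) f' t) :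
    f' ^ 2 ≤ dps c t ^ 2 * (1 - (R.eval t / DD c t) ^ 2) := by
  set f := R.eval t / DD c t with hf
  set p := dps c t with hp
  have hp0 : 0 ≤ p := dps_pos_or hc t
  set q := Real.sqrt ((p * f) ^ 2 + f' ^ 2) with hq
  have hq2 : q ^ 2 = (p * f) ^ 2 + f' ^ 2 := Real.sq_sqrt (by positivity)
  have hq0 : 0 ≤ q := Real.sqrt_nonneg _
  rcases hq0.eq_or_lt with h0 | h0
  · rw [← h0] at hq2
    nlinarith [sq_nonneg p]
  · have := BS_polar hc R hR hs1 hs t f' hf' (u := p * f / q) (v := -f' / q) (by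
      field_simp; linarith)
    rw [← hf, ← hp] at this
    have e : p * (1 - f * (p * f / q)) + f' * (-f' / q) = p - q := by
      field_simp
      linarith
    rw [e] at this
    nlinarith

lemma prod_le_of_roots (s : Multiset ℂ) (hs : ∀ w ∈ s, 0 < w.im) {z : ℂ} (hz : z.im < 0) :
    ‖(s.map fun w => (starRingEnd ℂ) z - w).prod‖ ≤ ‖(s.map fun w => z - w).prod‖ ∧
    (s ≠ 0 → ‖(s.map fun w => (starRingEnd ℂ) z - w).prod‖ < ‖(s.map fun w => z - w).prod‖) := by
  induction s using Multiset.induction_on with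
  | empty => simp
  | cons a s ih =>
    have ha := hs a (by simp)
    have ih' := (ih (fun w hw => hs w (by simp [hw]))).1
    have h1 : ‖(starRingEnd ℂ) z - a‖ < ‖z - a‖ := by
      apply lt_of_pow_lt_pow_left₀ 2 (norm_nonneg _)
      rw [Complex.sq_norm, Complex.sq_norm, Complex.normSq_apply, Complex.normSq_apply]
      simp
      nlinarith
    have h2 : 0 < ‖(s.map fun w => z - w).prod‖ := by
      rw [norm_pos_iff]
      apply Multiset.prod_ne_zero
      intro h
      obtain ⟨w, hw, h⟩ := Multiset.mem_map.1 h
      have := hs w (by simp [hw])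
      rw [sub_eq_zero] at h
      rw [h] at hz; linarith
    have : ‖((a ::ₘ s).map fun w => (starRingEnd ℂ) z - w).prod‖ <
        ‖((a ::ₘ s).map fun w => z - w).prod‖ := by
      simp only [Multiset.map_cons, Multiset.prod_cons, norm_mul]
      calc _ ≤ ‖(starRingEnd ℂ) z - a‖ * ‖(s.map fun w => z - w).prod‖ := by gcongr
        _ < _ := by gcongr
    exact ⟨this.le, fun _ => this⟩

lemma Gp_neg_eval (c : ι → ℝ) (z : ℂ) :
    (Gp (fun k => -c k)).eval z = (starRingEnd ℂ) ((Gp c).eval ((starRingEnd ℂ) z)) := by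
  rw [Gp_eval, Gp_eval, map_prod]
  refine Finset.prod_congr rfl fun k _ => ?_
  simp

lemma map_eval_conj (R : ℝ[X]) (z : ℂ) :
    (R.map (algebraMap ℝ ℂ)).eval ((starRingEnd ℂ) z) =
      (starRingEnd ℂ) ((R.map (algebraMap ℝ ℂ)).eval z) := by
  rw [eval_map_algebraMap, eval_map_algebraMap, Polynomial.aeval_conj]

noncomputable def AA (c : ι → ℝ) (R : ℝ[X]) : ℂ[X] :=
  Gp c + Gp (fun k => -c k) - 2 * R.map (algebraMap ℝ ℂ)

lemma AA_eval (c : ι → ℝ) (R : ℝ[X]) (z : ℂ) : (AA c R).eval z =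
    (Gp c - R.map (algebraMap ℝ ℂ)).eval z + (starRingEnd ℂ)
      ((Gp c - R.map (algebraMap ℝ ℂ)).eval ((starRingEnd ℂ) z)) := by
  simp only [AA, eval_sub, eval_add, eval_mul, Gp_neg_eval, map_eval_conj, map_sub, Complex.conj_conj]
  simp only [eval_ofNat]
  ring

lemma AA_root_aux {c : ι → ℝ} (hc : ∀ k, 0 < c k) (R : ℝ[X]) (hR : R.natDegree ≤ Fintype.card ι)
    {s : ℝ} (hs1 : s < 1) (hs : ∀ t : ℝ, |R.eval t| ≤ s * DD c t) {z : ℂ} (hz : z.im < 0) :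
    (AA c R).eval z ≠ 0 := by
  have hRc : (R.map (algebraMap ℝ ℂ)).natDegree ≤ Fintype.card ι := natDegree_map_le.trans hR
  intro h
  rw [AA_eval] at h
  set T := Gp c - R.map (algebraMap ℝ ℂ) with hT
  have hTne : ∀ w : ℂ, w.im ≤ 0 → T.eval w ≠ 0 := fun w hw => by
    have := T_ne hc _ hRc hs1 (hs_complex hs) (e := 1) (by simp) hw
    simpa [hT] using this
  have hroots : ∀ w ∈ T.roots, 0 < w.im := by
    intro w hw
    by_contra hcon
    exact hTne w (not_lt.1 hcon) (isRoot_of_mem_roots hw)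
  have hsp := IsAlgClosed.splits T
  have hl : T.leadingCoeff ≠ 0 := by
    rw [Ne, leadingCoeff_eq_zero]
    intro h0
    apply hTne 0 (by simp)
    simp [h0]
  by_cases h0 : T.roots = 0
  · have e1 : ∀ w, T.eval w = T.leadingCoeff := fun w => by
      rw [hsp.eval_eq_prod_roots, h0]; simp
    have e2 : T.eval 0 = ((1 - R.eval 0 : ℝ) : ℂ) := by
      have := map_eval_real R 0
      simp only [Complex.ofReal_zero] at this
      rw [hT, eval_sub, this, Gp_eval]
      simp
    rw [e1, e1, ← e1 0, e2, Complex.conj_ofReal, ← Complex.ofReal_add, Complex.ofReal_eq_zero] at h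
    apply hTne 0 (by simp)
    rw [e2]
    have : 1 - R.eval 0 = 0 := by linarith
    simp [this]
  · have h1 := (prod_le_of_roots T.roots hroots hz).2 h0
    have h2 : ‖T.eval z‖ = ‖T.eval ((starRingEnd ℂ) z)‖ := by
      rw [add_eq_zero_iff_eq_neg.1 h, norm_neg, Complex.norm_conj]
    rw [hsp.eval_eq_prod_roots, hsp.eval_eq_prod_roots, norm_mul, norm_mul] at h2
    have := mul_left_cancel₀ (norm_ne_zero_iff.2 hl) h2
    linarith

lemma AA_root {c : ι → ℝ} (hc : ∀ k, 0 < c k) (R : ℝ[X]) (hR : R.natDegree ≤ Fintype.card ι)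
    {s : ℝ} (hs1 : s < 1) (hs : ∀ t : ℝ, |R.eval t| ≤ s * DD c t) {z : ℂ}
    (hz : (AA c R).eval z = 0) : z.im = 0 := by
  rcases lt_trichotomy z.im 0 with h | h | h
  · exact absurd hz (AA_root_aux hc R hR hs1 hs h)
  · exact h
  · exfalso
    apply AA_root_aux hc R hR hs1 hs (z := (starRingEnd ℂ) z) (by simpa using h)
    rw [AA_eval] at hz ⊢
    rw [Complex.conj_conj]
    have := congrArg (starRingEnd ℂ) hz
    rw [map_add, Complex.conj_conj, map_zero] at this
    rw [add_comm]; exact this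

lemma AA_real (c : ι → ℝ) (R : ℝ[X]) (t : ℝ) :
    (AA c R).eval (t : ℂ) = ((2 * (DD c t * Real.cos (ps c t) - R.eval t) : ℝ) : ℂ) := by
  rw [AA_eval, Complex.conj_ofReal, eval_sub, map_eval_real, G_polar]
  rw [mul_comm I, Complex.exp_mul_I, ← Complex.ofReal_cos, ← Complex.ofReal_sin]
  apply Complex.ext
  · simp; ring
  · simp

lemma AA_deriv_real (c : ι → ℝ) (R : ℝ[X]) (t : ℝ) {d : ℝ} (hd : HasDerivAt (DD c) d t) :
    (AA c R).derivative.eval (t : ℂ) = ((2 * (d * Real.cos (ps c t) -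
      DD c t * (Real.sin (ps c t) * dps c t) - R.derivative.eval t) : ℝ) : ℂ) := by
  have h1 : HasDerivAt (fun x : ℝ => (AA c R).eval (x : ℂ)) ((AA c R).derivative.eval (t : ℂ)) t :=
    ((AA c R).hasDerivAt (t : ℂ)).comp_ofReal
  have h2 := (((hd.mul (hasDerivAt_ps c t).cos).sub (R.hasDerivAt t)).const_mul 2).ofReal_comp
  have h3 : (fun x : ℝ => (AA c R).eval (x : ℂ)) =
      (fun x : ℝ => ((2 * (DD c x * Real.cos (ps c x) - R.eval x) : ℝ) : ℂ)) :=
    funext fun x => AA_real c R x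
  rw [h3] at h1
  rw [h1.unique h2]
  congr 1
  ring

lemma DD_zero (c : ι → ℝ) : DD c 0 = 1 := by simp [DD]
lemma ps_zero (c : ι → ℝ) : ps c 0 = 0 := by simp [ps]

lemma DD_deriv_zero (c : ι → ℝ) : HasDerivAt (DD c) 0 0 := by
  obtain ⟨d, hd, -⟩ := hasDerivAt_DD c 0
  have h1 : HasDerivAt (fun x => DD c (-x)) (-d) 0 := by
    have := HasDerivAt.scomp (0:ℝ) (h := fun x : ℝ => -x) (h' := -1) (g₁ := DD c) (g₁' := d)
      (by simpa using hd) (hasDerivAt_neg' 0)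
    simpa [Function.comp_def] using this
  have h2 : (fun x => DD c (-x)) = DD c := by
    funext x; simp [DD]
  rw [h2] at h1
  have := hd.unique h1
  have : d = 0 := by linarith
  rwa [this] at hd

lemma AA_logderiv_nonpos {c : ι → ℝ} (hc : ∀ k, 0 < c k) (R : ℝ[X])
    (hR : R.natDegree ≤ Fintype.card ι) (hR0 : R.derivative.eval 0 = 0)
    {s : ℝ} (hs1 : s < 1) (hs : ∀ t : ℝ, |R.eval t| ≤ s * DD c t) {t : ℝ} (ht : 0 ≤ t)
    (hpos : ∀ x ∈ Icc 0 t, 0 < DD c x * Real.cos (ps c x) - R.eval x) :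
    ((AA c R).derivative.eval (t : ℂ) / (AA c R).eval (t : ℂ)).re ≤ 0 := by
  have hne : ∀ x ∈ Icc 0 t, (AA c R).eval (x : ℂ) ≠ 0 := by
    intro x hx h
    rw [AA_real, Complex.ofReal_eq_zero] at h
    have := hpos x hx
    linarith
  have hA0 : ((AA c R).derivative.eval ((0 : ℝ) : ℂ) / (AA c R).eval ((0 : ℝ) : ℂ)).re = 0 := by
    rw [AA_deriv_real c R 0 (DD_deriv_zero c), hR0, ps_zero]
    simp
  rw [← hA0]
  have hsp := IsAlgClosed.splits (AA c R)
  rw [hsp.eval_derivative_div_eval_of_ne_zero (hne t ⟨ht, le_refl _⟩),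
    hsp.eval_derivative_div_eval_of_ne_zero (hne 0 ⟨le_refl _, ht⟩)]
  rw [← Complex.reCLM_apply, ← Complex.reCLM_apply, map_multiset_sum, map_multiset_sum,
    Multiset.map_map, Multiset.map_map]
  apply Multiset.sum_map_le_sum_map
  intro z hz
  have hz0 : (AA c R).eval z = 0 := isRoot_of_mem_roots hz
  have him := AA_root hc R hR hs1 hs hz0
  obtain ⟨τ, rfl⟩ : ∃ τ : ℝ, z = (τ : ℂ) := ⟨z.re, Complex.ext (by simp) (by simp [him])⟩
  have hτ : τ ∉ Icc 0 t := fun h => hne τ h hz0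
  simp only [Function.comp, Complex.reCLM_apply, ← Complex.ofReal_sub, ← Complex.ofReal_one,
    ← Complex.ofReal_div, Complex.ofReal_re]
  by_cases h : 0 ≤ τ
  · have h2 : t < τ := by
      by_contra h3
      exact hτ ⟨h, not_lt.1 h3⟩
    have e1 : 1 / (t - τ) = - (1 / (τ - t)) := by rw [← neg_sub, one_div_neg_eq_neg_one_div]
    have e2 : 1 / (0 - τ) = - (1 / τ) := by rw [zero_sub, one_div_neg_eq_neg_one_div]
    rw [e1, e2, neg_le_neg_iff]
    apply one_div_le_one_div_of_le <;> linarith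
  · push Not at h
    apply one_div_le_one_div_of_le <;> linarith

lemma f_lt_one {c : ι → ℝ} {R : ℝ[X]} {s : ℝ} (hs : ∀ t : ℝ, |R.eval t| ≤ s * DD c t) (t : ℝ) :
    |R.eval t / DD c t| ≤ s := by
  rw [abs_div, abs_of_pos (DD_pos c t), div_le_iff₀ (DD_pos c t)]
  exact hs t

lemma ps_strictMono [Nonempty ι] {c : ι → ℝ} (hc : ∀ k, 0 < c k) : StrictMono (ps c) := by
  intro x y hxy
  apply Finset.sum_lt_sum_of_nonempty Finset.univ_nonempty
  intro k _
  exact Real.arctan_strictMono (mul_lt_mul_of_pos_left hxy (hc k))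

lemma pos_before [Nonempty ι] {c : ι → ℝ} (hc : ∀ k, 0 < c k) (R : ℝ[X])
    (hR : R.natDegree ≤ Fintype.card ι)
    {s : ℝ} (hs1 : s < 1) (hs : ∀ t : ℝ, |R.eval t| ≤ s * DD c t) {t : ℝ}
    (hps : ps c t < Real.pi / 2) (hlt : R.eval t / DD c t < Real.cos (ps c t)) :
    ∀ x ∈ Icc 0 t, 0 < DD c x * Real.cos (ps c x) - R.eval x := by
  intro x hx
  have hD := DD_pos c x
  suffices h : R.eval x / DD c x < Real.cos (ps c x) by
    rw [div_lt_iff₀ hD] at h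
    linarith
  rcases hx.1.eq_or_lt with h0 | h0
  · rw [← h0, ps_zero, Real.cos_zero]
    exact lt_of_le_of_lt (le_trans (le_abs_self _) (f_lt_one hs 0)) hs1
  · have hmono := ps_strictMono hc
    have hsin : ∀ y ∈ Icc x t, 0 < Real.sin (ps c y) := by
      intro y hy
      apply Real.sin_pos_of_pos_of_lt_pi
      · rw [← ps_zero c]; exact hmono (h0.trans_le hy.1)
      · have := hmono.monotone hy.2
        linarith [Real.pi_pos]
    have hder : ∀ y, ∃ f', HasDerivAt (fun x => R.eval x / DD c x) f' y := by
      intro y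
      obtain ⟨d, hd, -⟩ := hasDerivAt_DD c y
      exact ⟨_, (R.hasDerivAt y).div hd (DD_pos c y).ne'⟩
    choose f' hf' using hder
    have hh : ∀ y ∈ Icc x t, HasDerivAt
        (fun y => (Real.cos (ps c y) - R.eval y / DD c y) / Real.sin (ps c y))
        (-(dps c y * (1 - R.eval y / DD c y * Real.cos (ps c y)) + f' y * Real.sin (ps c y)) /
          Real.sin (ps c y) ^ 2) y := by
      intro y hy
      refine (((hasDerivAt_ps c y).cos.sub (hf' y)).div (hasDerivAt_ps c y).sin
        (hsin y hy).ne').congr_deriv ?_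
      congr 1
      have := Real.sin_sq_add_cos_sq (ps c y)
      simp only [Pi.sub_apply]
      linear_combination (-dps c y) * this
    have hanti : AntitoneOn
        (fun y => (Real.cos (ps c y) - R.eval y / DD c y) / Real.sin (ps c y)) (Icc x t) := by
      apply antitoneOn_of_deriv_nonpos (convex_Icc x t)
      · intro y hy
        exact (hh y hy).continuousAt.continuousWithinAt
      · intro y hy
        exact (hh y (interior_subset hy)).differentiableAt.differentiableWithinAt
      · intro y hy
        rw [(hh y (interior_subset hy)).deriv]
        apply div_nonpos_of_nonpos_of_nonneg _ (by positivity)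
        rw [neg_nonpos]
        exact BS_polar hc R hR hs1 hs y (f' y) (hf' y) (Real.cos_sq_add_sin_sq _)
    have h1 := hanti (left_mem_Icc.2 hx.2) (right_mem_Icc.2 hx.2) hx.2
    have h2 : 0 < (Real.cos (ps c t) - R.eval t / DD c t) / Real.sin (ps c t) :=
      div_pos (by linarith) (hsin t (right_mem_Icc.2 hx.2))
    have h3 := h2.trans_le h1
    have h4 := (div_pos_iff_of_pos_right (hsin x (left_mem_Icc.2 hx.2))).1 h3
    linarith

lemma end_one [Nonempty ι] {c : ι → ℝ} (hc : ∀ k, 0 < c k) (R : ℝ[X])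
    (hR : R.natDegree ≤ Fintype.card ι) (hR0 : R.derivative.eval 0 = 0)
    {s : ℝ} (hs1 : s < 1) (hs : ∀ t : ℝ, |R.eval t| ≤ s * DD c t) {t : ℝ} (ht : 0 ≤ t)
    (hps : ps c t < Real.pi / 2) (hlt : R.eval t / DD c t < Real.cos (ps c t)) {f' : ℝ}
    (hf' : HasDerivAt (fun x => R.eval x / DD c x) f' t) :
    -f' ≤ dps c t * Real.sin (ps c t) := by
  have hpos := pos_before hc R hR hs1 hs hps hlt
  have hlog := AA_logderiv_nonpos hc R hR hR0 hs1 hs ht hpos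
  obtain ⟨d, hd, hd0⟩ := hasDerivAt_DD c t
  have hD := DD_pos c t
  have hf2 : f' = (R.derivative.eval t * DD c t - R.eval t * d) / DD c t ^ 2 :=
    hf'.unique ((R.hasDerivAt t).div hd hD.ne')
  have hpt := hpos t ⟨ht, le_refl _⟩
  rw [AA_deriv_real c R t hd, AA_real, ← Complex.ofReal_div, Complex.ofReal_re,
    div_le_iff₀ (by linarith), zero_mul] at hlog
  have hR' : R.derivative.eval t = f' * DD c t + R.eval t / DD c t * d := by
    rw [hf2]; field_simp; ring
  have h1 : 0 ≤ d * (Real.cos (ps c t) - R.eval t / DD c t) := mul_nonneg (hd0 ht) (by linarith)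
  have h2 : DD c t * (-f') ≤ DD c t * (dps c t * Real.sin (ps c t)) := by
    rw [hR'] at hlog
    linarith
  exact le_of_mul_le_mul_left h2 hD

lemma end_two [Nonempty ι] {c : ι → ℝ} (hc : ∀ k, 0 < c k) (R : ℝ[X])
    (hR : R.natDegree ≤ Fintype.card ι) (hR0 : R.derivative.eval 0 = 0)
    {s : ℝ} (hs1 : s < 1) (hs : ∀ t : ℝ, |R.eval t| ≤ s * DD c t) {t : ℝ} (ht : 0 ≤ t)
    (hps : ps c t < Real.pi / 2) {f' : ℝ}
    (hf' : HasDerivAt (fun x => R.eval x / DD c x) f' t) :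
    |f'| ≤ dps c t * Real.sin (ps c t) := by
  have h0 : 0 ≤ ps c t := by
    rw [← ps_zero c]; exact (ps_strictMono hc).monotone ht
  have hsin : 0 ≤ Real.sin (ps c t) := Real.sin_nonneg_of_nonneg_of_le_pi h0 (by linarith [Real.pi_pos])
  have hcos : 0 ≤ Real.cos (ps c t) := Real.cos_nonneg_of_neg_pi_div_two_le_of_le
    (by linarith [Real.pi_pos]) hps.le
  have hdp := dps_pos_or hc t
  by_cases h : |R.eval t / DD c t| < Real.cos (ps c t)
  · rw [abs_lt] at h
    rw [abs_le]
    constructor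
    · linarith [end_one hc R hR hR0 hs1 hs ht hps h.2 hf']
    · have := end_one hc (-R) (by simpa using hR) (by simp [hR0]) hs1 (by simpa using hs) ht hps
        (by rw [eval_neg, neg_div]; linarith [h.1]) (f' := -f') (by
          refine hf'.neg.congr_of_eventuallyEq ?_
          filter_upwards with x
          simp [neg_div])
      linarith
  · push Not at h
    have := BS hc R hR hs1 hs t f' hf'
    apply abs_le_of_sq_le_sq _ (by positivity)
    refine this.trans ?_
    rw [mul_pow]
    gcongr
    rw [Real.sin_sq]
    have : Real.cos (ps c t) ^ 2 ≤ (R.eval t / DD c t) ^ 2 := by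
      rw [← sq_abs (R.eval t / DD c t)]; gcongr
    linarith

lemma le_of_scaled {b y : ℝ} (hb : 0 ≤ b) (h : ∀ s : ℝ, 0 ≤ s → s < 1 → s * y ≤ b) : y ≤ b := by
  by_contra hcon
  push Not at hcon
  have hy : 0 < y := by linarith
  have := h ((b + y) / (2 * y)) (by positivity) (by rw [div_lt_one (by positivity)]; linarith)
  have e : (b + y) / (2 * y) * y = (b + y) / 2 := by field_simp
  rw [e] at this
  linarith

lemma scaled_facts {c : ι → ℝ} {R : ℝ[X]}
    (hR : R.natDegree ≤ Fintype.card ι)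
    (hs : ∀ t : ℝ, |R.eval t| ≤ DD c t) {t : ℝ} {f' : ℝ}
    (hf' : HasDerivAt (fun x => R.eval x / DD c x) f' t) {s : ℝ} (hs0 : 0 ≤ s) :
    (C s * R).natDegree ≤ Fintype.card ι ∧ (∀ t : ℝ, |(C s * R).eval t| ≤ s * DD c t) ∧
    HasDerivAt (fun x => (C s * R).eval x / DD c x) (s * f') t := by
  refine ⟨(natDegree_C_mul_le _ _).trans hR, fun t => ?_, ?_⟩
  · rw [eval_mul, eval_C, abs_mul, abs_of_nonneg hs0]
    exact mul_le_mul_of_nonneg_left (hs t) hs0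
  · refine (hf'.const_mul s).congr_of_eventuallyEq ?_
    filter_upwards with x
    simp [mul_div_assoc]

lemma end_three [Nonempty ι] {c : ι → ℝ} (hc : ∀ k, 0 < c k) (R : ℝ[X])
    (hR : R.natDegree ≤ Fintype.card ι) (hR0 : R.derivative.eval 0 = 0)
    (hs : ∀ t : ℝ, |R.eval t| ≤ DD c t) {t : ℝ} (ht : 0 ≤ t)
    (hps : ps c t < Real.pi / 2) {f' : ℝ}
    (hf' : HasDerivAt (fun x => R.eval x / DD c x) f' t) :
    |f'| ≤ dps c t * Real.sin (ps c t) := by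
  have h0 : 0 ≤ ps c t := by
    rw [← ps_zero c]; exact (ps_strictMono hc).monotone ht
  have hsin : 0 ≤ Real.sin (ps c t) := Real.sin_nonneg_of_nonneg_of_le_pi h0 (by linarith [Real.pi_pos])
  refine le_of_scaled (mul_nonneg (dps_pos_or hc t) hsin) fun s hs0 hs1 => ?_
  obtain ⟨h1, h2, h3⟩ := scaled_facts hR hs hf' hs0
  have := end_two hc (C s * R) h1 (by simp [hR0]) hs1 h2 ht hps h3
  rwa [abs_mul, abs_of_nonneg hs0] at this

lemma bern {c : ι → ℝ} (hc : ∀ k, 0 < c k) (R : ℝ[X])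
    (hR : R.natDegree ≤ Fintype.card ι)
    (hs : ∀ t : ℝ, |R.eval t| ≤ DD c t) {t : ℝ} {f' : ℝ}
    (hf' : HasDerivAt (fun x => R.eval x / DD c x) f' t) :
    |f'| ≤ dps c t := by
  refine le_of_scaled (dps_pos_or hc t) fun s hs0 hs1 => ?_
  obtain ⟨h1, h2, h3⟩ := scaled_facts hR hs hf' hs0
  have := BS hc (C s * R) h1 hs1 h2 t _ h3
  have h4 : |s * f'| ≤ dps c t := by
    apply abs_le_of_sq_le_sq _ (dps_pos_or hc t)
    nlinarith [sq_nonneg (dps c t), sq_nonneg (dps c t * ((C s * R).eval t / DD c t))]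
  rwa [abs_mul, abs_of_nonneg hs0] at h4

/-! ### Passing to the variable x -/

noncomputable def xx (t : ℝ) : ℝ := (1 - t ^ 2) / (1 + t ^ 2)
noncomputable def cc {n : ℕ} (a : Fin (2 * n) → ℝ) (k : Fin (2 * n)) : ℝ :=
  Real.sqrt ((1 - a k) / (1 + a k))
noncomputable def rr {n : ℕ} (a : Fin (2 * n) → ℝ) (P : ℝ[X]) (x : ℝ) : ℝ :=
  P.eval x / Real.sqrt (∏ k, (1 + a k * x))
noncomputable def mm {n : ℕ} (a : Fin (2 * n) → ℝ) (x : ℝ) : ℝ :=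
  Real.cos ((1 / 2) * ∑ k, Real.arccos ((x + a k) / (1 + a k * x)))
noncomputable def QQ (n : ℕ) (P : ℝ[X]) : ℝ[X] :=
  ∑ j ∈ range (n + 1), C (P.coeff j) * ((1 - X) ^ j * (1 + X) ^ (n - j))
noncomputable def RR {n : ℕ} (a : Fin (2 * n) → ℝ) (P : ℝ[X]) : ℝ[X] :=
  C (∏ k, Real.sqrt (1 + a k))⁻¹ * (QQ n P).comp (X ^ 2)

lemma QQ_deg (n : ℕ) (P : ℝ[X]) : (QQ n P).natDegree ≤ n := by
  apply natDegree_sum_le_of_forall_le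
  intro j hj
  have hj' : j ≤ n := by have := Finset.mem_range.1 hj; omega
  refine (natDegree_C_mul_le _ _).trans (natDegree_mul_le.trans ?_)
  have h1 : ((1 - X : ℝ[X]) ^ j).natDegree ≤ j := by
    refine natDegree_pow_le.trans ?_
    have : (1 - X : ℝ[X]).natDegree ≤ 1 := by compute_degree
    nlinarith
  have h2 : ((1 + X : ℝ[X]) ^ (n - j)).natDegree ≤ n - j := by
    refine natDegree_pow_le.trans ?_
    have : (1 + X : ℝ[X]).natDegree ≤ 1 := by compute_degree
    nlinarith
  omega

section
variable {n : ℕ} {a : Fin (2 * n) → ℝ}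

lemma RR_deg (P : ℝ[X]) : (RR a P).natDegree ≤ Fintype.card (Fin (2 * n)) := by
  rw [Fintype.card_fin]
  refine (natDegree_C_mul_le _ _).trans ?_
  rw [natDegree_comp, natDegree_X_pow]
  have := QQ_deg n P
  omega

lemma RR_der (P : ℝ[X]) : (RR a P).derivative.eval 0 = 0 := by
  simp [RR, derivative_comp]

lemma cc_pos (ha : ∀ k, a k ∈ Ioo (-1 : ℝ) 1) (k) : 0 < cc a k := by
  have := ha k
  exact Real.sqrt_pos.2 (div_pos (by linarith [this.2]) (by linarith [this.1]))

lemma cc_sq (ha : ∀ k, a k ∈ Ioo (-1 : ℝ) 1) (k) : cc a k ^ 2 = (1 - a k) / (1 + a k) := by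
  have := ha k
  exact Real.sq_sqrt (div_nonneg (by linarith [this.2]) (by linarith [this.1]))

lemma xx_mem (t : ℝ) : xx t ∈ Icc (-1 : ℝ) 1 := by
  unfold xx
  constructor
  · rw [le_div_iff₀ (by positivity)]; linarith
  · rw [div_le_iff₀ (by positivity)]; nlinarith

lemma xx_mem_Ioo {t : ℝ} (ht : 0 < t) : xx t ∈ Ioo (-1 : ℝ) 1 := by
  unfold xx
  constructor
  · rw [lt_div_iff₀ (by positivity)]; linarith
  · rw [div_lt_iff₀ (by positivity)]; nlinarith [pow_pos ht 2]

lemma one_add_pos (ha : ∀ k, a k ∈ Ioo (-1 : ℝ) 1) {x : ℝ} (hx : x ∈ Icc (-1 : ℝ) 1) (k) :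
    0 < 1 + a k * x := by
  have h := abs_lt.2 ⟨(ha k).1, (ha k).2⟩
  have h2 := abs_le.2 ⟨hx.1, hx.2⟩
  have : |a k * x| < 1 := by
    rw [abs_mul]
    nlinarith [abs_nonneg (a k), abs_nonneg x]
  linarith [(abs_lt.1 this).1]

lemma one_add_xx (ha : ∀ k, a k ∈ Ioo (-1 : ℝ) 1) (t : ℝ) (k) :
    1 + a k * xx t = (1 + a k) * (1 + (cc a k * t) ^ 2) / (1 + t ^ 2) := by
  have h : 1 + a k ≠ 0 := by linarith [(ha k).1]
  rw [mul_pow, cc_sq ha, xx]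
  field_simp
  ring

lemma sqrt_prod_xx (ha : ∀ k, a k ∈ Ioo (-1 : ℝ) 1) (t : ℝ) :
    Real.sqrt (∏ k, (1 + a k * xx t)) =
      (∏ k, Real.sqrt (1 + a k)) * DD (cc a) t / (1 + t ^ 2) ^ n := by
  have hD := DD_pos (cc a) t
  have hC : 0 ≤ ∏ k, Real.sqrt (1 + a k) := Finset.prod_nonneg fun _ _ => Real.sqrt_nonneg _
  rw [Real.sqrt_eq_iff_mul_self_eq (Finset.prod_nonneg fun k _ => (one_add_pos ha (xx_mem t) k).le)
    (by positivity), ← sq]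
  rw [div_pow, mul_pow, DD, ← Finset.prod_pow, ← Finset.prod_pow, ← Finset.prod_mul_distrib,
    ← pow_mul, mul_comm n 2]
  have : (1 + t ^ 2) ^ (2 * n) = ∏ _k : Fin (2 * n), (1 + t ^ 2) := by simp
  rw [this, ← Finset.prod_div_distrib]
  refine Finset.prod_congr rfl fun k _ => ?_
  rw [one_add_xx ha, Real.sq_sqrt (by linarith [(ha k).1]), Real.sq_sqrt (by positivity)]

lemma P_xx (P : ℝ[X]) (hdeg : P.natDegree ≤ n) (t : ℝ) :
    (QQ n P).eval (t ^ 2) = P.eval (xx t) * (1 + t ^ 2) ^ n := by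
  rw [eval_eq_sum_range' (Nat.lt_succ_of_le hdeg), QQ, eval_finsetSum, Finset.sum_mul]
  refine Finset.sum_congr rfl fun j hj => ?_
  have hj' : j ≤ n := by have := Finset.mem_range.1 hj; omega
  have : (1 + t ^ 2) ^ n = (1 + t ^ 2) ^ j * (1 + t ^ 2) ^ (n - j) := by
    rw [← pow_add]; congr 1; omega
  rw [this, xx, div_pow]
  simp
  field_simp

lemma rr_xx (ha : ∀ k, a k ∈ Ioo (-1 : ℝ) 1) (P : ℝ[X]) (hdeg : P.natDegree ≤ n) (t : ℝ) :
    rr a P (xx t) = (RR a P).eval t / DD (cc a) t := by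
  rw [rr, sqrt_prod_xx ha, RR, eval_mul, eval_C, eval_comp, eval_pow, eval_X, P_xx P hdeg]
  have hC : ∏ k, Real.sqrt (1 + a k) ≠ 0 :=
    (Finset.prod_pos fun k _ => Real.sqrt_pos.2 (by linarith [(ha k).1])).ne'
  have hD := (DD_pos (cc a) t).ne'
  field_simp

lemma arctan_le_self' {u : ℝ} (hu : 0 ≤ u) : Real.arctan u ≤ u := by
  rcases hu.eq_or_lt with h | h
  · simp [← h]
  · have h1 := Real.lt_tan (Real.arctan_pos.2 h) (Real.arctan_lt_pi_div_two u)
    rw [Real.tan_arctan] at h1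
    exact h1.le

lemma arccos_arctan {u : ℝ} (hu : 0 ≤ u) :
    Real.arccos ((1 - u ^ 2) / (1 + u ^ 2)) = 2 * Real.arctan u := by
  have h : (1 - u ^ 2) / (1 + u ^ 2) = Real.cos (2 * Real.arctan u) := by
    rw [Real.cos_two_mul, Real.cos_sq_arctan]
    field_simp
    ring
  rw [h, Real.arccos_cos]
  · have := Real.arctan_nonneg.2 hu; linarith
  · have := Real.arctan_lt_pi_div_two u; linarith

lemma mm_xx (ha : ∀ k, a k ∈ Ioo (-1 : ℝ) 1) {t : ℝ} (ht : 0 ≤ t) :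
    mm a (xx t) = Real.cos (ps (cc a) t) := by
  rw [mm, ps, Finset.mul_sum]
  congr 1
  refine Finset.sum_congr rfl fun k _ => ?_
  have h := one_add_xx ha t k
  have h1 : 0 < 1 + a k := by linarith [(ha k).1]
  have : (xx t + a k) / (1 + a k * xx t) = (1 - (cc a k * t) ^ 2) / (1 + (cc a k * t) ^ 2) := by
    have h2 : xx t + a k = (1 + a k) * (1 - (cc a k * t) ^ 2) / (1 + t ^ 2) := by
      rw [mul_pow, cc_sq ha, xx]
      field_simp
      ring
    rw [h, h2]
    field_simp
  rw [this, arccos_arctan (mul_nonneg (cc_pos ha k).le ht)]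
  ring

lemma hasDerivAt_xx (t : ℝ) : HasDerivAt xx (-(4 * t / (1 + t ^ 2) ^ 2)) t := by
  have h1 : HasDerivAt (fun t : ℝ => 1 - t ^ 2) (-(2 * t)) t := by
    simpa using (hasDerivAt_pow 2 t).const_sub 1
  have h2 : HasDerivAt (fun t : ℝ => 1 + t ^ 2) (2 * t) t := by
    simpa using (hasDerivAt_pow 2 t).const_add 1
  refine (h1.div h2 (by positivity)).congr_deriv ?_
  field_simp
  ring

lemma rr_contDiffAt (ha : ∀ k, a k ∈ Ioo (-1 : ℝ) 1) (P : ℝ[X]) {x : ℝ} (hx : x ∈ Icc (-1 : ℝ) 1) :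
    ContDiffAt ℝ 1 (rr a P) x ∧ ContinuousAt (deriv (rr a P)) x := by
  have h : ContDiffAt ℝ 2 (rr a P) x := by
    have hpos : 0 < ∏ k, (1 + a k * x) := Finset.prod_pos fun k _ => one_add_pos ha hx k
    have h1 : ContDiffAt ℝ 2 (fun x => ∏ k, (1 + a k * x)) x := by
      apply contDiffAt_prod
      intro k _
      fun_prop
    have h2 := h1.sqrt hpos.ne'
    have h3 : ContDiffAt ℝ 2 (fun x => P.eval x) x := by
      have := (P.contDiff_aeval (𝕜 := ℝ) (n := 2)).contDiffAt (x := x)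
      simpa [coe_aeval_eq_eval] using this
    exact h3.div h2 (Real.sqrt_pos.2 hpos).ne'
  exact ⟨h.of_le (by norm_num), (ContDiffAt.derivWithin (m := 1) h (by norm_num)).continuousAt⟩

lemma mm_diff (ha : ∀ k, a k ∈ Ioo (-1 : ℝ) 1) {x : ℝ} (hx : x ∈ Ioo (-1 : ℝ) 1) :
    DifferentiableAt ℝ (mm a) x := by
  unfold mm
  apply DifferentiableAt.cos
  apply DifferentiableAt.const_mul
  apply DifferentiableAt.fun_sum
  intro k _
  have h0 := one_add_pos ha (Ioo_subset_Icc_self hx) k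
  have hk := ha k
  have h1 : DifferentiableAt ℝ (fun x => (x + a k) / (1 + a k * x)) x := by
    exact DifferentiableAt.fun_div (by fun_prop) (by fun_prop) h0.ne'
  refine DifferentiableAt.comp (g := Real.arccos) x (Real.differentiableAt_arccos.2 ⟨?_, ?_⟩) h1
  · intro h
    rw [div_eq_iff h0.ne'] at h
    nlinarith [mul_pos (by linarith [hk.1] : 0 < 1 + a k) (by linarith [hx.1] : 0 < 1 + x)]
  · intro h
    rw [div_eq_iff h0.ne'] at h
    nlinarith [mul_pos (by linarith [hk.2] : 0 < 1 - a k) (by linarith [hx.2] : 0 < 1 - x)]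

lemma rr_chain (ha : ∀ k, a k ∈ Ioo (-1 : ℝ) 1) (P : ℝ[X]) (hdeg : P.natDegree ≤ n) (t : ℝ) :
    HasDerivAt (fun x => (RR a P).eval x / DD (cc a) x)
      (deriv (rr a P) (xx t) * -(4 * t / (1 + t ^ 2) ^ 2)) t := by
  have h1 := ((rr_contDiffAt ha P (xx_mem t)).1.differentiableAt (by norm_num)).hasDerivAt
  have h2 := h1.comp t (hasDerivAt_xx t)
  refine h2.congr_of_eventuallyEq ?_
  filter_upwards with x
  rw [Function.comp, rr_xx ha P hdeg]

lemma mm_chain (ha : ∀ k, a k ∈ Ioo (-1 : ℝ) 1) {t : ℝ} (ht : 0 < t) :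
    |deriv (mm a) (xx t)| * (4 * t / (1 + t ^ 2) ^ 2) =
      dps (cc a) t * |Real.sin (ps (cc a) t)| := by
  have h1 := (mm_diff ha (xx_mem_Ioo ht)).hasDerivAt
  have h2 := h1.comp t (hasDerivAt_xx t)
  have h3 : HasDerivAt (fun x => Real.cos (ps (cc a) x))
      (deriv (mm a) (xx t) * -(4 * t / (1 + t ^ 2) ^ 2)) t := by
    refine h2.congr_of_eventuallyEq ?_
    filter_upwards [lt_mem_nhds ht] with x hx
    rw [Function.comp, mm_xx ha hx.le]
  have h4 := congrArg abs (h3.unique (hasDerivAt_ps (cc a) t).cos)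
  have h5 : (0 : ℝ) ≤ 4 * t / (1 + t ^ 2) ^ 2 := by positivity
  rw [abs_mul, abs_neg, abs_of_nonneg h5, abs_mul, abs_neg,
    abs_of_nonneg (dps_pos_or (cc_pos ha) t)] at h4
  rw [h4, mul_comm]

lemma RR_bound (ha : ∀ k, a k ∈ Ioo (-1 : ℝ) 1) (P : ℝ[X]) (hdeg : P.natDegree ≤ n)
    (hb : ∀ x ∈ Icc (-1 : ℝ) 1, |rr a P x| ≤ 1) (t : ℝ) : |(RR a P).eval t| ≤ DD (cc a) t := by
  have := hb _ (xx_mem t)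
  rwa [rr_xx ha P hdeg, abs_div, abs_of_pos (DD_pos _ t), div_le_one (DD_pos _ t)] at this

lemma end_x (hn : 0 < n) (ha : ∀ k, a k ∈ Ioo (-1 : ℝ) 1) (P : ℝ[X]) (hdeg : P.natDegree ≤ n)
    (hb : ∀ x ∈ Icc (-1 : ℝ) 1, |rr a P x| ≤ 1) {t : ℝ} (ht : 0 < t)
    (hps : ps (cc a) t < Real.pi / 2) :
    |deriv (rr a P) (xx t)| ≤ |deriv (mm a) (xx t)| := by
  have : Nonempty (Fin (2 * n)) := ⟨⟨0, by omega⟩⟩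
  have h := end_three (cc_pos ha) (RR a P) (RR_deg P) (RR_der P) (RR_bound ha P hdeg hb) ht.le hps
    (rr_chain ha P hdeg t)
  have h5 : (0 : ℝ) < 4 * t / (1 + t ^ 2) ^ 2 := by positivity
  rw [abs_mul, abs_neg, abs_of_pos h5] at h
  refine le_of_mul_le_mul_right ?_ h5
  rw [mm_chain ha ht]
  exact h.trans (mul_le_mul_of_nonneg_left (le_abs_self _) (dps_pos_or (cc_pos ha) t))

/-! ### Reflection -/

lemma mm_neg (x : ℝ) : mm (fun k => -a k) x = (-1) ^ n * mm a (-x) := by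
  rw [mm, mm, ← Real.cos_nat_mul_pi_sub]
  congr 1
  have : ∀ k, Real.arccos ((x + -a k) / (1 + -a k * x)) =
      Real.pi - Real.arccos ((-x + a k) / (1 + a k * -x)) := by
    intro k
    rw [← Real.arccos_neg]
    congr 1
    rw [← neg_div]
    congr 1 <;> ring
  simp only [this, Finset.sum_sub_distrib]
  simp
  ring

lemma deriv_mm_neg (x : ℝ) : |deriv (mm (fun k => -a k)) (-x)| = |deriv (mm a) x| := by
  have : mm (fun k => -a k) = fun x => (-1) ^ n * mm a (-x) := funext mm_neg
  rw [this, deriv_const_mul_field, deriv_comp_neg]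
  simp [abs_mul]

lemma rr_neg (P : ℝ[X]) (x : ℝ) : rr (fun k => -a k) (P.comp (-X)) x = rr a P (-x) := by
  simp [rr]

lemma deriv_rr_neg (P : ℝ[X]) (x : ℝ) :
    |deriv (rr (fun k => -a k) (P.comp (-X))) (-x)| = |deriv (rr a P) x| := by
  have : rr (fun k => -a k) (P.comp (-X)) = fun x => rr a P (-x) := funext (rr_neg P)
  rw [this, deriv_comp_neg]
  simp

lemma neg_mem (ha : ∀ k, a k ∈ Ioo (-1 : ℝ) 1) : ∀ k, (fun k => -a k) k ∈ Ioo (-1 : ℝ) 1 :=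
  fun k => ⟨by linarith [(ha k).2], by linarith [(ha k).1]⟩

lemma xx_inv {t : ℝ} (ht : 0 < t) : xx t⁻¹ = -xx t := by
  unfold xx
  field_simp
  ring

lemma cc_neg (k) : cc (fun k => -a k) k = (cc a k)⁻¹ := by
  unfold cc
  rw [← Real.sqrt_inv]
  simp [sub_eq_add_neg]

lemma ps_neg (ha : ∀ k, a k ∈ Ioo (-1 : ℝ) 1) {t : ℝ} (ht : 0 < t) :
    ps (cc (fun k => -a k)) t⁻¹ = n * Real.pi - ps (cc a) t := by
  unfold ps
  have : ∀ k, Real.arctan (cc (fun k => -a k) k * t⁻¹) = Real.pi / 2 - Real.arctan (cc a k * t) := by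
    intro k
    rw [cc_neg, ← mul_inv, Real.arctan_inv_of_pos (mul_pos (cc_pos ha k) ht)]
  simp only [this, Finset.sum_sub_distrib]
  simp
  ring

lemma end_x' (hn : 0 < n) (ha : ∀ k, a k ∈ Ioo (-1 : ℝ) 1) (P : ℝ[X]) (hdeg : P.natDegree ≤ n)
    (hb : ∀ x ∈ Icc (-1 : ℝ) 1, |rr a P x| ≤ 1) {t : ℝ} (ht : 0 < t)
    (hps : n * Real.pi - Real.pi / 2 < ps (cc a) t) :
    |deriv (rr a P) (xx t)| ≤ |deriv (mm a) (xx t)| := by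
  have h := end_x hn (neg_mem ha) (P.comp (-X)) (by
      rw [natDegree_comp, natDegree_neg, natDegree_X, mul_one]; exact hdeg) (by
      intro x hx
      rw [rr_neg]
      exact hb _ ⟨by linarith [hx.2], by linarith [hx.1]⟩) (inv_pos.2 ht) (by
      rw [ps_neg ha ht]; linarith)
  rwa [xx_inv ht, deriv_mm_neg, deriv_rr_neg] at h

lemma mm_bdd (ha : ∀ k, a k ∈ Ioo (-1 : ℝ) 1) {t : ℝ} (ht : 0 < t) (ht1 : t ≤ 1) :
    |deriv (mm a) (xx t)| ≤ (∑ k, cc a k) ^ 2 := by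
  have h := mm_chain ha ht
  have h5 : (0 : ℝ) < 4 * t / (1 + t ^ 2) ^ 2 := by positivity
  have hS : 0 ≤ ∑ k, cc a k := Finset.sum_nonneg fun k _ => (cc_pos ha k).le
  have hps0 : 0 ≤ ps (cc a) t := Finset.sum_nonneg fun k _ =>
    Real.arctan_nonneg.2 (mul_nonneg (cc_pos ha k).le ht.le)
  have h1 : ps (cc a) t ≤ (∑ k, cc a k) * t := by
    rw [Finset.sum_mul]
    exact Finset.sum_le_sum fun k _ => arctan_le_self' (mul_nonneg (cc_pos ha k).le ht.le)
  have h2 : dps (cc a) t ≤ ∑ k, cc a k := by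
    refine Finset.sum_le_sum fun k _ => ?_
    apply div_le_self (cc_pos ha k).le
    nlinarith [sq_nonneg (cc a k * t)]
  have h3 : |Real.sin (ps (cc a) t)| ≤ (∑ k, cc a k) * t :=
    (Real.abs_sin_le_abs).trans (by rwa [abs_of_nonneg hps0])
  have h4 : t ≤ 4 * t / (1 + t ^ 2) ^ 2 := by
    rw [le_div_iff₀ (by positivity)]
    have : t ^ 2 ≤ 1 := by nlinarith
    have : (1 + t ^ 2) ^ 2 ≤ 4 := by nlinarith [sq_nonneg t]
    nlinarith
  refine le_of_mul_le_mul_right ?_ h5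
  rw [h]
  calc _ ≤ (∑ k, cc a k) * ((∑ k, cc a k) * t) := mul_le_mul h2 h3 (abs_nonneg _) hS
    _ = (∑ k, cc a k) ^ 2 * t := by ring
    _ ≤ _ := by gcongr

lemma mm_bdd' (ha : ∀ k, a k ∈ Ioo (-1 : ℝ) 1) : ∃ K, ∀ t : ℝ, 0 < t → |deriv (mm a) (xx t)| ≤ K := by
  refine ⟨max ((∑ k, cc a k) ^ 2) ((∑ k, cc (fun k => -a k) k) ^ 2), fun t ht => ?_⟩
  rcases le_total t 1 with h | h
  · exact (mm_bdd ha ht h).trans (le_max_left _ _)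
  · have := mm_bdd (neg_mem ha) (inv_pos.2 ht) (inv_le_one_of_one_le₀ h)
    rw [xx_inv ht, deriv_mm_neg] at this
    exact this.trans (le_max_right _ _)

lemma xx_surj {x : ℝ} (hx : x ∈ Ioo (-1 : ℝ) 1) : ∃ t, 0 < t ∧ xx t = x := by
  have h1 : 0 < 1 - x := by linarith [hx.2]
  have h2 : 0 < 1 + x := by linarith [hx.1]
  refine ⟨Real.sqrt ((1 - x) / (1 + x)), Real.sqrt_pos.2 (div_pos h1 h2), ?_⟩
  rw [xx, Real.sq_sqrt (div_pos h1 h2).le]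
  field_simp
  ring

/-! ### The interior -/

lemma concave_log_affine {p q : ℝ} (h : ∀ x ∈ Ioo (-1 : ℝ) 1, 0 < p + q * x) :
    ConcaveOn ℝ (Ioo (-1 : ℝ) 1) (fun x => Real.log (p + q * x)) := by
  refine ⟨convex_Ioo _ _, fun x hx y hy α β hα hβ hab => ?_⟩
  have := strictConcaveOn_log_Ioi.concaveOn.2 (h x hx) (h y hy) hα hβ hab
  refine this.trans_eq ?_
  simp only [smul_eq_mul]
  congr 1
  linear_combination p * hab

noncomputable def lam (c x : ℝ) : ℝ :=
  c / (Real.sqrt (1 - x ^ 2) * ((1 + c ^ 2) + (1 - c ^ 2) * x))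

lemma lam_convex {c : ℝ} (hc : 0 < c) : ConvexOn ℝ (Ioo (-1 : ℝ) 1) (lam c) := by
  have p1 : ∀ x ∈ Ioo (-1 : ℝ) 1, 0 < 1 + 1 * x := fun x hx => by linarith [hx.1]
  have p2 : ∀ x ∈ Ioo (-1 : ℝ) 1, 0 < 1 + (-1) * x := fun x hx => by linarith [hx.2]
  have p3 : ∀ x ∈ Ioo (-1 : ℝ) 1, 0 < (1 + c ^ 2) + (1 - c ^ 2) * x := fun x hx => by
    have e : (1 + c ^ 2) + (1 - c ^ 2) * x = (1 + x) + c ^ 2 * (1 - x) := by ring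
    rw [e]
    have := mul_pos (pow_pos hc 2) (by linarith [hx.2] : 0 < 1 - x)
    linarith [hx.1]
  have h1 := concave_log_affine p1
  have h2 := concave_log_affine p2
  have h3 := concave_log_affine p3
  have hform : ∀ x ∈ Ioo (-1 : ℝ) 1, lam c x = Real.exp (Real.log c - (1 / 2 * Real.log (1 + 1 * x) +
      1 / 2 * Real.log (1 + (-1) * x) + Real.log ((1 + c ^ 2) + (1 - c ^ 2) * x))) := by
    intro x hx
    have q1 := p1 x hx
    have q2 := p2 x hx
    have q3 := p3 x hx
    have e : 1 - x ^ 2 = (1 + 1 * x) * (1 + (-1) * x) := by ring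
    rw [lam, Real.exp_sub, Real.exp_log hc, Real.exp_add, Real.exp_log q3, ← mul_add,
      ← Real.log_mul q1.ne' q2.ne', ← e]
    congr 2
    have q4 : 0 < 1 - x ^ 2 := by rw [e]; positivity
    rw [mul_comm, ← Real.rpow_def_of_pos q4, Real.sqrt_eq_rpow]
  refine ⟨convex_Ioo _ _, fun x hx y hy α β hα hβ hab => ?_⟩
  rw [hform _ ((convex_Ioo (-1 : ℝ) 1) hx hy hα hβ hab), hform x hx, hform y hy]
  refine le_trans ?_ (convexOn_exp.2 (mem_univ _) (mem_univ _) hα hβ hab)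
  apply Real.exp_le_exp.2
  have k1 := h1.2 hx hy hα hβ hab
  have k2 := h2.2 hx hy hα hβ hab
  have k3 := h3.2 hx hy hα hβ hab
  simp only [smul_eq_mul] at k1 k2 k3 ⊢
  have : Real.log c = α * Real.log c + β * Real.log c := by rw [← add_mul, hab, one_mul]
  linarith

noncomputable def Lam {n : ℕ} (a : Fin (2 * n) → ℝ) (x : ℝ) : ℝ := ∑ k, lam (cc a k) x

lemma Lam_convex (ha : ∀ k, a k ∈ Ioo (-1 : ℝ) 1) : ConvexOn ℝ (Ioo (-1 : ℝ) 1) (Lam a) := by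
  refine ⟨convex_Ioo _ _, fun x hx y hy α β hα hβ hab => ?_⟩
  unfold Lam
  rw [Finset.smul_sum, Finset.smul_sum, ← Finset.sum_add_distrib]
  exact Finset.sum_le_sum fun k _ => (lam_convex (cc_pos ha k)).2 hx hy hα hβ hab

lemma Lam_xx {t : ℝ} (ht : 0 < t) :
    Lam a (xx t) * (4 * t / (1 + t ^ 2) ^ 2) = dps (cc a) t := by
  have hs : Real.sqrt (1 - xx t ^ 2) = 2 * t / (1 + t ^ 2) := by
    rw [← Real.sqrt_sq (by positivity : 0 ≤ 2 * t / (1 + t ^ 2))]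
    congr 1
    unfold xx
    field_simp
    ring
  unfold Lam dps
  rw [Finset.sum_mul]
  refine Finset.sum_congr rfl fun k _ => ?_
  have e : (1 + cc a k ^ 2) + (1 - cc a k ^ 2) * xx t = 2 * (1 + (cc a k * t) ^ 2) / (1 + t ^ 2) := by
    unfold xx
    field_simp
    ring
  rw [lam, hs, e]
  have : 1 + (cc a k * t) ^ 2 ≠ 0 := by positivity
  field_simp
  try ring

lemma rr_le_Lam (ha : ∀ k, a k ∈ Ioo (-1 : ℝ) 1) (P : ℝ[X]) (hdeg : P.natDegree ≤ n)
    (hb : ∀ x ∈ Icc (-1 : ℝ) 1, |rr a P x| ≤ 1) {t : ℝ} (ht : 0 < t) :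
    |deriv (rr a P) (xx t)| ≤ Lam a (xx t) := by
  have h := bern (cc_pos ha) (RR a P) (RR_deg P) (RR_bound ha P hdeg hb) (rr_chain ha P hdeg t)
  have h5 : (0 : ℝ) < 4 * t / (1 + t ^ 2) ^ 2 := by positivity
  rw [abs_mul, abs_neg, abs_of_pos h5] at h
  refine le_of_mul_le_mul_right ?_ h5
  rwa [Lam_xx ht]

lemma Lam_eq (ha : ∀ k, a k ∈ Ioo (-1 : ℝ) 1) {t : ℝ} (ht : 0 < t)
    (hsin : |Real.sin (ps (cc a) t)| = 1) : Lam a (xx t) = |deriv (mm a) (xx t)| := by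
  have h5 : (0 : ℝ) < 4 * t / (1 + t ^ 2) ^ 2 := by positivity
  refine mul_right_cancel₀ h5.ne' ?_
  rw [Lam_xx ht, mm_chain ha ht, hsin, mul_one]

lemma ps_exists (ha : ∀ k, a k ∈ Ioo (-1 : ℝ) 1) {y : ℝ} (hy0 : 0 < y) (hy : y < n * Real.pi) :
    ∃ t, 0 < t ∧ ps (cc a) t = y := by
  have hlim : Filter.Tendsto (ps (cc a)) Filter.atTop (nhds (n * Real.pi)) := by
    have : (n * Real.pi : ℝ) = ∑ _k : Fin (2 * n), Real.pi / 2 := by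
      simp; ring
    rw [this]
    refine tendsto_finsetSum _ fun k _ => ?_
    exact ((Real.tendsto_arctan_atTop).mono_right nhdsWithin_le_nhds).comp
      (Filter.tendsto_id.const_mul_atTop (cc_pos ha k))
  obtain ⟨T, hT, hT0⟩ := ((hlim.eventually_const_lt hy).and (Filter.eventually_ge_atTop 0)).exists
  have hcont : ContinuousOn (ps (cc a)) (Icc 0 T) := fun x _ =>
    (hasDerivAt_ps (cc a) x).continuousAt.continuousWithinAt
  obtain ⟨t, ht, hty⟩ := intermediate_value_Icc hT0 hcont (show y ∈ Set.Icc _ _ from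
    ⟨by rw [ps_zero]; exact hy0.le, hT.le⟩)
  refine ⟨t, lt_of_le_of_ne ht.1 ?_, hty⟩
  intro h
  rw [← h, ps_zero] at hty
  exact hy0.ne hty

lemma xx_anti {s t : ℝ} (hs : 0 ≤ s) (h : s ≤ t) : xx t ≤ xx s := by
  unfold xx
  rw [div_le_div_iff₀ (by positivity) (by positivity)]
  have : s ^ 2 ≤ t ^ 2 := by gcongr
  nlinarith

lemma pointwise (hn : 0 < n) (ha : ∀ k, a k ∈ Ioo (-1 : ℝ) 1) (P : ℝ[X]) (hdeg : P.natDegree ≤ n)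
    (hb : ∀ x ∈ Icc (-1 : ℝ) 1, |rr a P x| ≤ 1) {t : ℝ} (ht : 0 < t) :
    ∃ u, 0 < u ∧ |deriv (rr a P) (xx t)| ≤ |deriv (mm a) (xx u)| := by
  have : Nonempty (Fin (2 * n)) := ⟨⟨0, by omega⟩⟩
  by_cases h1 : ps (cc a) t < Real.pi / 2
  · exact ⟨t, ht, end_x hn ha P hdeg hb ht h1⟩
  by_cases h2 : n * Real.pi - Real.pi / 2 < ps (cc a) t
  · exact ⟨t, ht, end_x' hn ha P hdeg hb ht h2⟩
  push Not at h1 h2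
  have hpi := Real.pi_pos
  have hn1 : (1 : ℝ) ≤ n := by exact_mod_cast hn
  obtain ⟨u, hu, hpu⟩ := ps_exists ha (y := Real.pi / 2) (by positivity) (by nlinarith)
  obtain ⟨v, hv, hpv⟩ := ps_exists ha (y := n * Real.pi - Real.pi / 2) (by nlinarith) (by linarith)
  have hmono := ps_strictMono (cc_pos ha)
  have hut : u ≤ t := hmono.le_iff_le.1 (by rw [hpu]; exact h1)
  have htv : t ≤ v := hmono.le_iff_le.1 (by rw [hpv]; exact h2)
  have hsu : |Real.sin (ps (cc a) u)| = 1 := by rw [hpu]; simp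
  have hsv : |Real.sin (ps (cc a) v)| = 1 := by
    rw [hpv, Real.sin_sub_pi_div_two, Real.cos_nat_mul_pi]
    simp
  have h3 := (rr_le_Lam ha P hdeg hb ht).trans ((Lam_convex ha).le_max_of_mem_Icc (xx_mem_Ioo hv)
    (xx_mem_Ioo hu) ⟨xx_anti ht.le htv, xx_anti hu.le hut⟩)
  rcases le_max_iff.1 h3 with h | h
  · exact ⟨v, hv, by rwa [Lam_eq ha hv hsv] at h⟩
  · exact ⟨u, hu, by rwa [Lam_eq ha hu hsu] at h⟩

end

end Rusak

theorem rusak_sup_norm_markov_one_interval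
    (n : ℕ) (hn : 0 < n)
    (a : Fin (2 * n) → ℝ) (ha : ∀ k, a k ∈ Ioo (-1 : ℝ) 1)
    (P : Polynomial ℝ) (hdeg : P.natDegree ≤ n)
    (r m : ℝ → ℝ)
    (hr : ∀ x : ℝ, r x = P.eval x / Real.sqrt (∏ k, (1 + a k * x)))
    (hm : ∀ x : ℝ, m x =
      Real.cos ((1 / 2) * ∑ k, Real.arccos ((x + a k) / (1 + a k * x))))
    (hbound : ∀ x ∈ Icc (-1 : ℝ) 1, |r x| ≤ 1) :
    sSup ((fun x => |deriv r x|) '' Icc (-1 : ℝ) 1) ≤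
      sSup ((fun x => |deriv m x|) '' Icc (-1 : ℝ) 1) := by
  have hr' : r = Rusak.rr a P := funext hr
  have hm' : m = Rusak.mm a := funext hm
  subst hr' hm'
  have hbdd : BddAbove ((fun x => |deriv (Rusak.mm a) x|) '' Icc (-1 : ℝ) 1) := by
    obtain ⟨K, hK⟩ := Rusak.mm_bdd' ha
    refine ⟨max K (max |deriv (Rusak.mm a) (-1)| |deriv (Rusak.mm a) 1|), ?_⟩
    rintro _ ⟨x, hx, rfl⟩
    rcases hx.1.eq_or_lt with h | h
    · subst h
      exact (le_max_left _ _).trans (le_max_right _ _)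
    rcases hx.2.eq_or_lt with h' | h'
    · subst h'
      exact (le_max_right _ _).trans (le_max_right _ _)
    obtain ⟨t, ht, rfl⟩ := Rusak.xx_surj ⟨h, h'⟩
    exact (hK t ht).trans (le_max_left _ _)
  set S := sSup ((fun x => |deriv (Rusak.mm a) x|) '' Icc (-1 : ℝ) 1) with hS
  have hIoo : ∀ x ∈ Ioo (-1 : ℝ) 1, |deriv (Rusak.rr a P) x| ≤ S := by
    intro x hx
    obtain ⟨t, ht, rfl⟩ := Rusak.xx_surj hx
    obtain ⟨u, hu, h⟩ := Rusak.pointwise hn ha P hdeg hbound ht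
    exact h.trans (le_csSup hbdd ⟨Rusak.xx u, Rusak.xx_mem u, rfl⟩)
  refine csSup_le ((Set.nonempty_Icc.2 (by norm_num)).image _) ?_
  rintro _ ⟨x, hx, rfl⟩
  have hcl : x ∈ closure (Ioo (-1 : ℝ) 1) := by
    rw [closure_Ioo (by norm_num)]; exact hx
  have hc : ContinuousWithinAt (fun x => |deriv (Rusak.rr a P) x|) (Ioo (-1 : ℝ) 1) x :=
    ((Rusak.rr_contDiffAt ha P hx).2.abs).continuousWithinAt
  exact ContinuousWithinAt.closure_le hcl hc continuousWithinAt_const hIoo
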